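/- (Macaulay formula.) Let F_0, ..., F_n ∈ ℂ[x_0,...,x_n] be homogeneous of degrees d_0, ..., d_n, let δ = Σ_{i=0}^n d_i − n and N = binom(n+δ, n). Then det(𝔻(F_0,...,F_n)) = Res(F_0,...,F_n) · det(𝔻'(F_0,...,F_n)), where 𝔻 is the N×N coefficient matrix of the linear system given by the N polynomials (x^α / x_i^{d_i}) · F_i for i = 0,...,n and x^α ∈ S_i (regarding the monomials of total degree δ as unknowns), and 𝔻' is the submatrix of 𝔻 obtained by deleting all rows and columns corresponding to reduced monomials. -/

import Mathlib

open MvPolynomial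

/-- `Mono m e` is the type of exponent vectors of total degree `e` in `m` variables. -/
abbrev Mono (m e : ℕ) : Type := {α : Fin m → ℕ // ∑ j, α j = e}

instance (m e : ℕ) : Fintype (Mono m e) :=
  Fintype.subtype (Finset.Nat.antidiagonalTuple m e) fun _ => Finset.Nat.mem_antidiagonalTuple

/-- The exponent vector as a finitely supported function (a monomial of `MvPolynomial`). -/
noncomputable abbrev Mono.toFinsupp {m e : ℕ} (α : Mono m e) : Fin m →₀ ℕ :=
  Finsupp.equivFunOnFinite.symm α.1

/-- The index type for the variables `u_{i,α}` of the universal ring of coefficients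
`ℤ[u_{i,α} : i, |α| = d i]` for `m` forms of degrees `d 0, …, d (m-1)` in `m` variables. -/
abbrev CoeffIdx (m : ℕ) (d : Fin m → ℕ) : Type := Σ i : Fin m, Mono m (d i)

/-- Evaluation `P ↦ P(F_0, …, F_{m-1})` : each universal variable `u_{i,α}` is replaced by the
corresponding coefficient `c_{i,α}` of `F_i`. -/
noncomputable def resEval {m : ℕ} (d : Fin m → ℕ) (F : Fin m → MvPolynomial (Fin m) ℂ)
    (R : MvPolynomial (CoeffIdx m d) ℤ) : ℂ :=
  eval₂ (Int.castRingHom ℂ) (fun v => coeff v.2.toFinsupp (F v.1)) R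

/-- `IsResultant m d R` says that `R` is *the* resultant polynomial `Res_{d_0,…,d_n}` (`m = n+1`):
(1) for homogeneous `F_i` of degrees `d i`, the system `F_0 = ⋯ = F_n = 0` has a nontrivial
solution over `ℂ` iff `R(F_0,…,F_n) = 0`; (2) `R` is irreducible, even over `ℂ`;
(3) `R(x_0^{d_0},…,x_n^{d_n}) = 1`. -/
def IsResultant (m : ℕ) (d : Fin m → ℕ) (R : MvPolynomial (CoeffIdx m d) ℤ) : Prop :=
  (∀ F : Fin m → MvPolynomial (Fin m) ℂ, (∀ i, (F i).IsHomogeneous (d i)) →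
    ((∃ x : Fin m → ℂ, x ≠ 0 ∧ ∀ i, eval x (F i) = 0) ↔ resEval d F R = 0)) ∧
  Irreducible R ∧ Irreducible (MvPolynomial.map (Int.castRingHom ℂ) R) ∧
  resEval d (fun i => X i ^ d i) R = 1

/-- The set of indices `i` such that `x_i^{d_i}` divides the monomial `x^α`. -/
def divisorSet {m : ℕ} (d : Fin m → ℕ) {δ : ℕ} (α : Mono m δ) : Finset (Fin m) :=
  Finset.univ.filter fun i => d i ≤ α.1 i

/-- The minimal index `i` such that `x_i^{d_i}` divides `x^α` (junk value `0` if there is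
none; for `|α| = δ = ∑ d_i - n` such an index always exists). -/
def minIdx {n : ℕ} (d : Fin (n + 1) → ℕ) {δ : ℕ} (α : Mono (n + 1) δ) : Fin (n + 1) :=
  if h : (divisorSet d α).Nonempty then (divisorSet d α).min' h else 0

/-- A monomial `x^α` of total degree `δ` is *reduced* if `x_i^{d_i}` divides `x^α` for exactly
one `i`. -/
def IsReducedMono {n : ℕ} (d : Fin (n + 1) → ℕ) {δ : ℕ} (α : Mono (n + 1) δ) : Prop :=
  (divisorSet d α).card = 1

instance {n : ℕ} (d : Fin (n + 1) → ℕ) (δ : ℕ) :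
    DecidablePred (IsReducedMono d (δ := δ)) := fun α => by
  unfold IsReducedMono; infer_instance

/-- The Macaulay matrix `𝔻(F_0,…,F_n)`: the `N × N` coefficient matrix (with `N = #{x^α :
|α| = δ}`, the monomials of degree `δ` being regarded as unknowns) of the linear system given
by the `N` polynomials `(x^α / x_i^{d_i}) ⬝ F_i`, for `i = 0,…,n` and `x^α ∈ S_i`, i.e. `i`
minimal with `x_i^{d_i} ∣ x^α`. Row `α`, column `β` holds the coefficient of `x^β` in
`(x^α / x_{i(α)}^{d_{i(α)}}) ⬝ F_{i(α)}`. -/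
noncomputable def macaulayMatrix {n : ℕ} (d : Fin (n + 1) → ℕ) (δ : ℕ)
    (F : Fin (n + 1) → MvPolynomial (Fin (n + 1)) ℂ) :
    Matrix (Mono (n + 1) δ) (Mono (n + 1) δ) ℂ :=
  Matrix.of fun α β =>
    coeff β.toFinsupp
      ((monomial (α.toFinsupp - Finsupp.single (minIdx d α) (d (minIdx d α)))) (1 : ℂ) *
        F (minIdx d α))

theorem exists_dvd_pow_of_eval_eq_zero {σ : Type*} [Finite σ] {f q : MvPolynomial σ ℂ}
    (h : ∀ x, eval x f = 0 → eval x q = 0) : ∃ N, f ∣ q ^ N := by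
  have hq : q ∈ (Ideal.span {f}).radical := by
    rw [← vanishingIdeal_zeroLocus_eq_radical (K := ℂ), mem_vanishingIdeal_iff]
    intro x hx
    have hf : aeval x f = 0 := hx f (Ideal.mem_span_singleton_self f)
    rw [aeval_eq_eval] at hf ⊢
    exact h x hf
  obtain ⟨N, hN⟩ := hq
  exact ⟨N, Ideal.mem_span_singleton.1 hN⟩

theorem Prime.dvd_of_eval_eq_zero {σ : Type*} [Finite σ] {p f : MvPolynomial σ ℂ} (hp : Prime p)
    (h : ∀ x, eval x p = 0 → eval x f = 0) : p ∣ f := by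
  obtain ⟨N, hN⟩ := exists_dvd_pow_of_eval_eq_zero h
  exact hp.dvd_of_dvd_pow hN

theorem Prime.eq_C_mul_pow_of_eval_eq_zero {σ : Type*} [Finite σ] {f q : MvPolynomial σ ℂ}
    (hq : Prime q) (h : ∀ x, eval x f = 0 → eval x q = 0) :
    ∃ (a : ℂ) (k : ℕ), f = C a * q ^ k := by
  obtain ⟨N, hN⟩ := exists_dvd_pow_of_eval_eq_zero h
  obtain ⟨k, -, u, hu⟩ := (dvd_prime_pow hq N).1 hN
  obtain ⟨a, -, ha⟩ := MvPolynomial.isUnit_iff_eq_C_of_isReduced.1 (u⁻¹).isUnit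
  refine ⟨a, k, ?_⟩
  rw [← ha, ← hu, mul_comm, Units.mul_inv_cancel_right]

theorem exists_prime_dvd_of_vanishing {σ : Type*} {Z : Set (σ → ℂ)} (hZ : Z.Nonempty)
    (hprime : ∀ f g : MvPolynomial σ ℂ, (∀ x ∈ Z, eval x (f * g) = 0) →
      (∀ x ∈ Z, eval x f = 0) ∨ ∀ x ∈ Z, eval x g = 0)
    {f : MvPolynomial σ ℂ} (hf : f ≠ 0) (hfZ : ∀ x ∈ Z, eval x f = 0) :
    ∃ q, Prime q ∧ q ∣ f ∧ ∀ x ∈ Z, eval x q = 0 := by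
  induction f using UniqueFactorizationMonoid.induction_on_prime with
  | h₁ => exact absurd rfl hf
  | h₂ f hu =>
    obtain ⟨x, hx⟩ := hZ
    exact absurd (hfZ x hx) (hu.map (eval x)).ne_zero
  | h₃ a p ha hp ih =>
    rcases hprime p a hfZ with h | h
    · exact ⟨p, hp, dvd_mul_right p a, h⟩
    · obtain ⟨q, hq, hqa, hqZ⟩ := ih ha h
      exact ⟨q, hq, hqa.mul_left p, hqZ⟩

section Weighted

variable {σ R : Type*} [CommRing R]

/-- The substitution `X v ↦ T ^ w v * X v`, recording the weight in the power of `T`. -/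
noncomputable def weightLift (w : σ → ℕ) :
    MvPolynomial σ R →ₐ[R] Polynomial (MvPolynomial σ R) :=
  aeval fun v => Polynomial.C (X v) * Polynomial.X ^ w v

theorem weightLift_monomial (w : σ → ℕ) (s : σ →₀ ℕ) (a : R) :
    weightLift w (monomial s a) =
      Polynomial.C (monomial s a) * Polynomial.X ^ Finsupp.weight w s := by
  rw [weightLift, aeval_monomial, monomial_eq, Finsupp.weight_apply, Finsupp.sum,
    ← Finset.prod_pow_eq_pow_sum, Polynomial.C_mul, Finsupp.prod, Finsupp.prod, map_prod, mul_assoc,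
    ← Finset.prod_mul_distrib]
  refine congrArg₂ _ rfl (Finset.prod_congr rfl fun v _ => ?_)
  rw [mul_pow, Polynomial.C_pow, smul_eq_mul, ← pow_mul, mul_comm (s v)]

theorem coeff_weightLift (w : σ → ℕ) (f : MvPolynomial σ R) (k : ℕ) :
    (weightLift w f).coeff k = weightedHomogeneousComponent w k f := by
  induction f using MvPolynomial.induction_on' with
  | monomial s a =>
    rw [weightLift_monomial, Polynomial.coeff_C_mul_X_pow]
    ext t
    rw [coeff_weightedHomogeneousComponent]
    by_cases hst : s = t
    · subst hst
      by_cases hk : k = Finsupp.weight w s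
      · simp [hk]
      · simp [hk, Ne.symm hk]
    · classical
      simp only [coeff_monomial, if_neg hst, ite_self]
      split_ifs
      · rw [coeff_monomial, if_neg hst]
      · rw [coeff_zero]
  | add p q hp hq => simp [hp, hq]

theorem weightLift_eq {w : σ → ℕ} {f : MvPolynomial σ R} {k : ℕ}
    (hf : IsWeightedHomogeneous w f k) :
    weightLift w f = Polynomial.C f * Polynomial.X ^ k := by
  ext1 l
  rw [coeff_weightLift, Polynomial.coeff_C_mul_X_pow]
  split_ifs with h
  · rw [h, hf.weightedHomogeneousComponent_same]
  · exact hf.weightedHomogeneousComponent_ne l h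

theorem eval_one_weightLift (w : σ → ℕ) (f : MvPolynomial σ R) :
    (weightLift w f).eval 1 = f := by
  have h : ((Polynomial.aeval (1 : MvPolynomial σ R)).restrictScalars R).comp (weightLift w) =
      AlgHom.id R (MvPolynomial σ R) := by
    ext v
    simp [weightLift]
  simpa using congrArg (fun φ => φ f) h

theorem weightLift_ne_zero (w : σ → ℕ) {f : MvPolynomial σ R} (hf : f ≠ 0) :
    weightLift w f ≠ 0 := fun h => hf <| by rw [← eval_one_weightLift w f, h, Polynomial.eval_zero]

theorem isWeightedHomogeneous_of_natDegree_le [IsDomain R] {w : σ → ℕ} {f : MvPolynomial σ R}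
    (h : (weightLift w f).natDegree ≤ (weightLift w f).natTrailingDegree) :
    IsWeightedHomogeneous w f (weightLift w f).natDegree := by
  set k := (weightLift w f).natDegree with hk
  have h1 : weightLift w f = Polynomial.monomial k ((weightLift w f).coeff k) := by
    ext1 l
    rw [Polynomial.coeff_monomial]
    split_ifs with hl
    · rw [hl]
    · rcases lt_or_gt_of_ne hl with hl | hl
      · exact Polynomial.coeff_eq_zero_of_natDegree_lt hl
      · exact Polynomial.coeff_eq_zero_of_lt_natTrailingDegree (hl.trans_le h)
  have h2 := eval_one_weightLift w f
  rw [h1, Polynomial.eval_monomial, one_pow, mul_one, coeff_weightLift] at h2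
  rw [← h2]
  exact weightedHomogeneousComponent_isWeightedHomogeneous k f

/-- The factors of a nonzero weighted homogeneous polynomial are weighted homogeneous. -/
theorem exists_isWeightedHomogeneous_of_mul [IsDomain R] {w : σ → ℕ} {f g : MvPolynomial σ R}
    {N : ℕ} (h : IsWeightedHomogeneous w (f * g) N) (h0 : f * g ≠ 0) :
    ∃ a b, a + b = N ∧ IsWeightedHomogeneous w f a ∧ IsWeightedHomogeneous w g b := by
  have hf := weightLift_ne_zero w (left_ne_zero_of_mul h0)
  have hg := weightLift_ne_zero w (right_ne_zero_of_mul h0)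
  have key : weightLift w f * weightLift w g = Polynomial.monomial N (f * g) := by
    rw [← map_mul, weightLift_eq h, Polynomial.C_mul_X_pow_eq_monomial]
  have h1 : (weightLift w f).natDegree + (weightLift w g).natDegree = N := by
    rw [← Polynomial.natDegree_mul hf hg, key, Polynomial.natDegree_monomial_eq N h0]
  have h2 : (weightLift w f).natTrailingDegree + (weightLift w g).natTrailingDegree = N := by
    rw [← Polynomial.natTrailingDegree_mul hf hg, key, Polynomial.natTrailingDegree_monomial h0]
  have h3 := (weightLift w f).natTrailingDegree_le_natDegree
  have h4 := (weightLift w g).natTrailingDegree_le_natDegree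
  exact ⟨_, _, h1, isWeightedHomogeneous_of_natDegree_le (by omega),
    isWeightedHomogeneous_of_natDegree_le (by omega)⟩

theorem MvPolynomial.IsWeightedHomogeneous.eval_pow_mul {w : σ → ℕ} {f : MvPolynomial σ R} {k : ℕ}
    (hf : IsWeightedHomogeneous w f k) (s : R) (u : σ → R) :
    eval (fun v => s ^ w v * u v) f = s ^ k * eval u f := by
  rw [eval_eq, eval_eq, Finset.mul_sum]
  refine Finset.sum_congr rfl fun t ht => ?_
  rw [← hf (mem_support_iff.1 ht), Finsupp.weight_apply, Finsupp.sum,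
    ← Finset.prod_pow_eq_pow_sum, mul_left_comm, ← Finset.prod_mul_distrib]
  congr 1
  refine Finset.prod_congr rfl fun v _ => ?_
  rw [mul_pow, ← pow_mul, smul_eq_mul, mul_comm (t v)]

theorem MvPolynomial.IsWeightedHomogeneous.natDegree_aeval_le {w : σ → ℕ} {f : MvPolynomial σ R}
    {k : ℕ}
    (hf : IsWeightedHomogeneous w f k) {g : σ → Polynomial R}
    (hg : ∀ v, (g v).natDegree ≤ w v) : (aeval g f).natDegree ≤ k := by
  rw [aeval_def, eval₂_eq]
  refine Polynomial.natDegree_sum_le_of_forall_le _ _ fun s hs => ?_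
  rw [← hf (mem_support_iff.1 hs), Polynomial.algebraMap_eq]
  refine (Polynomial.natDegree_C_mul_le _ _).trans ((Polynomial.natDegree_prod_le _ _).trans ?_)
  rw [Finsupp.weight_apply, Finsupp.sum]
  refine Finset.sum_le_sum fun v _ => Polynomial.natDegree_pow_le.trans ?_
  exact Nat.mul_le_mul_left _ (hg v)

theorem MvPolynomial.IsWeightedHomogeneous.eval_congr_of_zero {w : σ → ℕ} {f : MvPolynomial σ R}
    (hf : IsWeightedHomogeneous w f 0) {u u' : σ → R} (h : ∀ v, w v = 0 → u v = u' v) :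
    eval u f = eval u' f := by
  rw [eval_eq, eval_eq]
  refine Finset.sum_congr rfl fun s hs => ?_
  congr 1
  refine Finset.prod_congr rfl fun v hv => ?_
  rw [h v]
  have h0 := hf (mem_support_iff.1 hs)
  rw [Finsupp.weight_apply, Finsupp.sum, Finset.sum_eq_zero_iff] at h0
  simpa [Finsupp.mem_support_iff.1 hv] using h0 v hv

end Weighted

/-- Entry of the Macaulay matrix: the coefficient of `x ^ β` in `(x ^ α / x i ^ d i) * F i`,
where `F i` is the form with coefficients `u ⟨i, ·⟩`. -/
def macaulayEntry {A : Type*} [CommRing A] {m : ℕ} {d : Fin m → ℕ} {t : ℕ}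
    (u : CoeffIdx m d → A) (i : Fin m) (α β : Mono m t) : A :=
  ∑ γ : Mono m (d i), if β.1 + Pi.single i (d i) = α.1 + γ.1 then u ⟨i, γ⟩ else 0

/-- The Macaulay matrix in degree `t` of the system with coefficients `u`, for the choice `c` of
an index for each monomial. -/
def macaulayOf {A : Type*} [CommRing A] {m : ℕ} {d : Fin m → ℕ} {t : ℕ}
    (c : Mono m t → Fin m) (u : CoeffIdx m d → A) : Matrix (Mono m t) (Mono m t) A :=
  Matrix.of fun α β => macaulayEntry u (c α) α β

/-- The value at `x` of the `i`-th form of the system with coefficients `u`. -/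
def formEval {A : Type*} [CommRing A] {m : ℕ} {d : Fin m → ℕ}
    (u : CoeffIdx m d → A) (x : Fin m → A) (i : Fin m) : A :=
  ∑ γ : Mono m (d i), u ⟨i, γ⟩ * ∏ j, x j ^ γ.1 j

/-- The system with coefficients `u` has a nontrivial common zero. -/
def HasZero {m : ℕ} {d : Fin m → ℕ} (u : CoeffIdx m d → ℂ) : Prop :=
  ∃ x : Fin m → ℂ, x ≠ 0 ∧ ∀ i, formEval u x i = 0

/-- The monomial `x j ^ e`. -/
def purePow {m : ℕ} (j : Fin m) (e : ℕ) : Mono m e := ⟨Pi.single j e, by simp⟩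

/-- The coefficients of the system `x i ^ d i`. -/
def powSystem (A : Type*) [CommRing A] {m : ℕ} (d : Fin m → ℕ) : CoeffIdx m d → A :=
  fun v => if v.2 = purePow v.1 (d v.1) then 1 else 0

/-- The weight counting the degree in the coefficients of the `j`-th form. -/
def formWeight {m : ℕ} {d : Fin m → ℕ} (j : Fin m) (v : CoeffIdx m d) : ℕ :=
  if v.1 = j then 1 else 0

/-- `p` is the resultant, as a polynomial over `ℂ`. -/
structure IsComplexResultant {m : ℕ} {d : Fin m → ℕ} (p : MvPolynomial (CoeffIdx m d) ℂ) :
    Prop where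
  prime : Prime p
  eval_eq_zero_iff : ∀ u, eval u p = 0 ↔ HasZero u
  eval_powSystem : eval (powSystem ℂ d) p = 1

section Basic

variable {A B : Type*} [CommRing A] [CommRing B] {m : ℕ} {d : Fin m → ℕ} {t : ℕ}

theorem map_macaulayEntry (φ : A →+* B) (u : CoeffIdx m d → A) (i : Fin m) (α β : Mono m t) :
    φ (macaulayEntry u i α β) = macaulayEntry (fun v => φ (u v)) i α β := by
  simp only [macaulayEntry, map_sum, apply_ite φ, map_zero]

theorem eval_det_macaulayOf_submatrix {ι : Type*} [Fintype ι] [DecidableEq ι] (e : ι → Mono m t)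
    (c : Mono m t → Fin m) (u : CoeffIdx m d → A) :
    eval u ((macaulayOf c (X : CoeffIdx m d → MvPolynomial _ A)).submatrix e e).det =
      ((macaulayOf c u).submatrix e e).det := by
  rw [RingHom.map_det]
  congr 1
  ext α β
  simp [macaulayOf, map_macaulayEntry]

theorem eval_det_macaulayOf (c : Mono m t → Fin m) (u : CoeffIdx m d → A) :
    eval u (macaulayOf c (X : CoeffIdx m d → MvPolynomial _ A)).det = (macaulayOf c u).det :=
  eval_det_macaulayOf_submatrix id c u

theorem macaulayEntry_powSystem (i : Fin m) (α β : Mono m t) :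
    macaulayEntry (powSystem A d) i α β = if α = β then 1 else 0 := by
  unfold macaulayEntry powSystem
  rw [Finset.sum_eq_single (purePow i (d i))]
  · simp [purePow, eq_comm, Subtype.ext_iff]
  · intro γ _ hγ
    simp [hγ]
  · simp

theorem formEval_powSystem (x : Fin m → A) (i : Fin m) :
    formEval (powSystem A d) x i = x i ^ d i := by
  unfold formEval powSystem
  rw [Finset.sum_eq_single (purePow i (d i))]
  · rw [if_pos rfl, one_mul, Finset.prod_eq_single i] <;> simp +contextual [purePow]
  · intro γ _ hγ
    simp [hγ]
  · simp

theorem det_macaulayOf_powSystem (c : Mono m t → Fin m) :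
    (macaulayOf c (powSystem A d)).det = 1 := by
  have : macaulayOf c (powSystem A d) = 1 := by
    ext α β
    simp [macaulayOf, macaulayEntry_powSystem, Matrix.one_apply]
  rw [this, Matrix.det_one]

theorem sum_macaulayEntry_mul (u : CoeffIdx m d → A) (x : Fin m → A) {i : Fin m} {α : Mono m t}
    (h : d i ≤ α.1 i) :
    ∑ β : Mono m t, macaulayEntry u i α β * ∏ j, x j ^ β.1 j =
      (∏ j, x j ^ (α.1 - Pi.single i (d i) : Fin m → ℕ) j) * formEval u x i := by
  have hle : (Pi.single i (d i) : Fin m → ℕ) ≤ α.1 := by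
    intro j
    by_cases hj : j = i
    · subst hj; simpa using h
    · simp [hj]
  simp only [macaulayEntry, formEval, Finset.sum_mul, Finset.mul_sum]
  rw [Finset.sum_comm]
  refine Finset.sum_congr rfl fun γ _ => ?_
  have hs : ∑ j, (α.1 - Pi.single i (d i) + γ.1 : Fin m → ℕ) j = t := by
    have h1 : ∑ j, (α.1 - Pi.single i (d i) + Pi.single i (d i) : Fin m → ℕ) j = t := by
      rw [tsub_add_cancel_of_le hle, α.2]
    have h2 := γ.2
    simp only [Pi.add_apply, Finset.sum_add_distrib] at h1 ⊢
    rw [h2]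
    simpa using h1
  rw [Finset.sum_eq_single ⟨_, hs⟩]
  · have : (α.1 - Pi.single i (d i) + γ.1 : Fin m → ℕ) + Pi.single i (d i) = α.1 + γ.1 := by
      rw [add_right_comm, tsub_add_cancel_of_le hle]
    rw [if_pos this]
    simp only [Pi.add_apply, pow_add, Finset.prod_mul_distrib]
    ring
  · intro β _ hβ
    rw [if_neg, zero_mul]
    intro hc
    refine hβ (Subtype.ext (add_right_cancel (b := Pi.single i (d i)) ?_))
    rw [hc, add_right_comm, tsub_add_cancel_of_le hle]
  · simp

theorem det_macaulayOf_eq_zero {c : Mono m t → Fin m} (hc : ∀ α, d (c α) ≤ α.1 (c α))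
    {u : CoeffIdx m d → ℂ} (hu : HasZero u) : (macaulayOf c u).det = 0 := by
  obtain ⟨x, hx, h⟩ := hu
  rw [← Matrix.exists_mulVec_eq_zero_iff]
  refine ⟨fun β => ∏ j, x j ^ β.1 j, ?_, ?_⟩
  · obtain ⟨j, hj⟩ := Function.ne_iff.1 hx
    intro h0
    have h1 := congrFun h0 (purePow j t)
    simp only [purePow, Pi.zero_apply] at h1
    rw [Finset.prod_eq_single j] at h1
    · simp only [Pi.single_eq_same] at h1
      exact pow_ne_zero t hj h1
    · simp +contextual
    · simp
  · ext α
    simp only [Matrix.mulVec, dotProduct, macaulayOf, Matrix.of_apply]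
    rw [sum_macaulayEntry_mul u x (hc α), h, mul_zero, Pi.zero_apply]

theorem isWeightedHomogeneous_macaulayEntry (i j : Fin m) (α β : Mono m t) :
    IsWeightedHomogeneous (formWeight j)
      (macaulayEntry (X : CoeffIdx m d → MvPolynomial _ A) i α β) (if i = j then 1 else 0) := by
  refine IsWeightedHomogeneous.sum _ _ _ fun γ _ => ?_
  by_cases h1 : β.1 + Pi.single i (d i) = α.1 + γ.1
  · rw [if_pos h1]
    exact isWeightedHomogeneous_X A (formWeight j) (⟨i, γ⟩ : CoeffIdx m d)
  · rw [if_neg h1]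
    exact isWeightedHomogeneous_zero A _ _

theorem isWeightedHomogeneous_det_macaulayOf (c : Mono m t → Fin m) (j : Fin m) :
    IsWeightedHomogeneous (formWeight j)
      (macaulayOf c (X : CoeffIdx m d → MvPolynomial _ A)).det
      (Finset.univ.filter fun α => c α = j).card := by
  rw [Matrix.det_apply]
  refine IsWeightedHomogeneous.sum _ _ _ fun σ _ => ?_
  have h : IsWeightedHomogeneous (formWeight j)
      (∏ α, macaulayOf c (X : CoeffIdx m d → MvPolynomial _ A) (σ α) α)
      (Finset.univ.filter fun α => c α = j).card := by
    rw [Finset.card_filter, ← Equiv.sum_comp σ]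
    exact IsWeightedHomogeneous.prod _ _ _ fun α _ =>
      isWeightedHomogeneous_macaulayEntry (c (σ α)) j (σ α) α
  rcases Int.units_eq_one_or (Equiv.Perm.sign σ) with hσ | hσ
  · simpa [hσ] using h
  · simpa [hσ] using h.neg

end Basic

section Degree

variable {m : ℕ} {d : Fin m → ℕ} {t : ℕ}

/-- The exponents `f` with `f i < d i` for `i ≠ j`, and `f j = 0`. -/
def boxExcept (d : Fin m → ℕ) (j : Fin m) : Finset (Fin m → ℕ) :=
  Fintype.piFinset fun i => if i = j then {0} else Finset.range (d i)

theorem card_boxExcept (d : Fin m → ℕ) (j : Fin m) :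
    (boxExcept d j).card = ∏ i ∈ Finset.univ.erase j, d i := by
  rw [boxExcept, Fintype.card_piFinset, ← Finset.mul_prod_erase _ _ (Finset.mem_univ j)]
  simp only [if_true, Finset.card_singleton, one_mul]
  refine Finset.prod_congr rfl fun i hi => ?_
  rw [if_neg (Finset.ne_of_mem_erase hi), Finset.card_range]

theorem mem_boxExcept {j : Fin m} {f : Fin m → ℕ} :
    f ∈ boxExcept d j ↔ f j = 0 ∧ ∀ i ≠ j, f i < d i := by
  rw [boxExcept, Fintype.mem_piFinset]
  constructor
  · intro h
    refine ⟨by simpa using h j, fun i hi => by simpa [hi] using h i⟩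
  · rintro ⟨h1, h2⟩ i
    by_cases hi : i = j
    · simp [hi, h1]
    · simpa [hi] using h2 i hi

theorem card_filter_lt_le (j : Fin m) {S : Finset (Mono m t)}
    (hS : ∀ α ∈ S, ∀ i ≠ j, α.1 i < d i) : S.card ≤ ∏ i ∈ Finset.univ.erase j, d i := by
  rw [← card_boxExcept]
  refine Finset.card_le_card_of_injOn (fun α => Function.update α.1 j 0) ?_ ?_
  · intro α hα
    rw [Finset.mem_coe, mem_boxExcept]
    exact ⟨by simp, fun i hi => by simpa [hi] using hS α hα i hi⟩
  · intro α _ β _ h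
    have h' : ∀ i ≠ j, α.1 i = β.1 i := fun i hi => by simpa [hi] using congrFun h i
    have hα := α.2
    have hβ := β.2
    rw [← Finset.add_sum_erase _ _ (Finset.mem_univ j)] at hα hβ
    have hs : ∑ i ∈ Finset.univ.erase j, α.1 i = ∑ i ∈ Finset.univ.erase j, β.1 i :=
      Finset.sum_congr rfl fun i hi => h' i (Finset.ne_of_mem_erase hi)
    ext i
    by_cases hi : i = j
    · subst hi; omega
    · exact h' i hi

theorem exists_le_apply (ht : ∑ i, (d i - 1) < t) (α : Mono m t) : ∃ i, d i ≤ α.1 i := by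
  by_contra! h
  have := Finset.sum_le_sum fun i (_ : i ∈ Finset.univ) => Nat.le_sub_one_of_lt (h i)
  rw [α.2] at this
  omega

theorem exists_choice_last (ht : ∑ i, (d i - 1) < t) (j : Fin m) :
    ∃ c : Mono m t → Fin m, (∀ α, d (c α) ≤ α.1 (c α)) ∧
      ∀ α, c α = j → ∀ i ≠ j, α.1 i < d i := by
  have h : ∀ α : Mono m t, ∃ k, d k ≤ α.1 k ∧ (k = j → ∀ i ≠ j, α.1 i < d i) := by
    intro α
    by_cases h : ∃ i ≠ j, d i ≤ α.1 i
    · obtain ⟨i, hi, hd⟩ := h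
      exact ⟨i, hd, fun h => absurd h hi⟩
    · push Not at h
      obtain ⟨k, hk⟩ := exists_le_apply ht α
      exact ⟨k, hk, fun _ => h⟩
  choose c hc using h
  exact ⟨c, fun α => (hc α).1, fun α => (hc α).2⟩

theorem Mono.toFinsupp_injective {m e : ℕ} :
    Function.Injective (Mono.toFinsupp : Mono m e → Fin m →₀ ℕ) :=
  fun _ _ h => Subtype.ext (Finsupp.equivFunOnFinite.symm.injective h)

/-- The coefficients of a family of forms. -/
noncomputable def coeffSystem (d : Fin m → ℕ) (F : Fin m → MvPolynomial (Fin m) ℂ) :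
    CoeffIdx m d → ℂ :=
  fun v => coeff v.2.toFinsupp (F v.1)

theorem formEval_coeffSystem {F : Fin m → MvPolynomial (Fin m) ℂ} {i : Fin m}
    (hF : (F i).IsHomogeneous (d i)) (x : Fin m → ℂ) :
    formEval (coeffSystem d F) x i = eval x (F i) := by
  rw [eval_eq', formEval]
  have h1 : ∑ γ : Mono m (d i), coeffSystem d F ⟨i, γ⟩ * ∏ j, x j ^ γ.1 j =
      ∑ s ∈ Finset.univ.image (Mono.toFinsupp : Mono m (d i) → Fin m →₀ ℕ),
        coeff s (F i) * ∏ j, x j ^ s j := by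
    rw [Finset.sum_image fun a _ b _ h => Mono.toFinsupp_injective h]
    rfl
  rw [h1]
  refine (Finset.sum_subset ?_ ?_).symm
  · intro s hs
    have h2 := hF (mem_support_iff.1 hs)
    rw [Finset.mem_image]
    refine ⟨⟨s, ?_⟩, Finset.mem_univ _, by ext; rfl⟩
    rw [← h2, Finsupp.weight_apply, Finsupp.sum_fintype] <;> simp
  · intro s _ hs
    rw [notMem_support_iff.1 hs, zero_mul]

theorem IsComplexResultant.le_degree {p : MvPolynomial (CoeffIdx m d) ℂ}
    (hp : IsComplexResultant p) (hd : ∀ i, 0 < d i) (j : Fin m) {a : ℕ}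
    (ha : IsWeightedHomogeneous (formWeight j) p a) : ∏ i ∈ Finset.univ.erase j, d i ≤ a := by
  set b : ℕ := 1 + ∑ i, d i with hb
  have hdb : ∀ i, d i < b := fun i => by
    have := Finset.single_le_sum (f := d) (fun _ _ => Nat.zero_le _) (Finset.mem_univ i)
    omega
  let G : Fin m → MvPolynomial (Fin m) ℂ := fun i =>
    if i = j then -((∑ i ∈ Finset.univ.erase j, X i) * X j ^ (d j - 1))
    else ∏ k ∈ Finset.range (d i), (X i - C ((k : ℂ) * (b : ℂ) ^ (i : ℕ)) * X j)
  have hG : ∀ i, (G i).IsHomogeneous (d i) := by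
    intro i
    by_cases hi : i = j
    · subst hi
      simp only [G, if_true]
      refine IsHomogeneous.neg ?_
      have h1 : (∑ k ∈ Finset.univ.erase i, (X k : MvPolynomial (Fin m) ℂ)).IsHomogeneous 1 :=
        IsHomogeneous.sum _ _ _ fun k _ => isHomogeneous_X ℂ k
      have h2 := h1.mul (isHomogeneous_X_pow (R := ℂ) i (d i - 1))
      rwa [Nat.add_sub_cancel' (hd i)] at h2
    · simp only [G, if_neg hi]
      have h1 := IsHomogeneous.prod (Finset.range (d i))
        (fun k : ℕ => X i - C ((k : ℂ) * (b : ℂ) ^ (i : ℕ)) * X j) (fun _ => 1) fun k _ =>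
          (isHomogeneous_X ℂ i).sub ((isHomogeneous_X ℂ j).C_mul ((k : ℂ) * (b : ℂ) ^ (i : ℕ)))
      simpa using h1
  let g : CoeffIdx m d → Polynomial ℂ := fun v =>
    Polynomial.C (coeffSystem d G v) +
      if v.1 = j then Polynomial.C (powSystem ℂ d v) * Polynomial.X else 0
  let q : Polynomial ℂ := aeval g p
  have hq : q.natDegree ≤ a := ha.natDegree_aeval_le fun v => by
    simp only [g, formWeight]
    split_ifs
    · compute_degree
    · simp
  have hqe : ∀ s, q.eval s = 0 ↔ HasZero (fun v => (g v).eval s) := by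
    intro s
    rw [← hp.eval_eq_zero_iff]
    have : q.eval s = eval (fun v => (g v).eval s) p := by
      have h := MvPolynomial.comp_aeval_apply (f := g) (Polynomial.aeval (R := ℂ) s) p
      simpa [q, Polynomial.coe_aeval_eq_eval, aeval_eq_eval] using h
    rw [this]
  have hform : ∀ s x i, formEval (fun v => (g v).eval s) x i =
      eval x (G i) + if i = j then s * x j ^ d j else 0 := by
    intro s x i
    rw [← formEval_coeffSystem (hG i)]
    by_cases hi : i = j
    · subst hi
      rw [if_pos rfl, ← formEval_powSystem]
      simp only [formEval, g, if_true, Finset.mul_sum, ← Finset.sum_add_distrib]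
      refine Finset.sum_congr rfl fun γ _ => ?_
      simp
      ring
    · simp [formEval, g, hi]
  have hGne : ∀ x i, i ≠ j →
      (eval x (G i) = 0 ↔ ∃ k < d i, x i = (k : ℂ) * (b : ℂ) ^ (i : ℕ) * x j) := by
    intro x i hi
    simp [G, hi, Finset.prod_eq_zero_iff, sub_eq_zero]
  have hGj : ∀ x, eval x (G j) = -((∑ i ∈ Finset.univ.erase j, x i) * x j ^ (d j - 1)) := by
    intro x
    simp [G]
  let root : (Fin m → ℕ) → ℕ := fun f => ∑ i, f i * b ^ (i : ℕ)
  have hroot : ∀ f, f j = 0 →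
      ((root f : ℕ) : ℂ) = ∑ i ∈ Finset.univ.erase j, (f i : ℂ) * (b : ℂ) ^ (i : ℕ) := by
    intro f hf
    simp only [root]
    rw [← Finset.add_sum_erase _ _ (Finset.mem_univ j), hf]
    simp
  have hmem : ∀ s, q.eval s = 0 ↔ ∃ f ∈ boxExcept d j, s = (root f : ℕ) := by
    intro s
    rw [hqe]
    constructor
    · rintro ⟨x, hx, h⟩
      simp only [hform] at h
      have h1 : ∀ i, ∃ k, i ≠ j → k < d i ∧ x i = (k : ℂ) * (b : ℂ) ^ (i : ℕ) * x j := by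
        intro i
        by_cases hi : i = j
        · exact ⟨0, fun h => absurd hi h⟩
        · obtain ⟨k, hk⟩ := (hGne x i hi).1 (by simpa [hi] using h i)
          exact ⟨k, fun _ => hk⟩
      choose k hk using h1
      have hxj : x j ≠ 0 := by
        intro h0
        refine hx (funext fun i => ?_)
        by_cases hi : i = j
        · rw [hi, h0, Pi.zero_apply]
        · rw [(hk i hi).2, h0, mul_zero, Pi.zero_apply]
      refine ⟨Function.update k j 0, mem_boxExcept.2 ⟨by simp, fun i hi => ?_⟩, ?_⟩
      · simpa [hi] using (hk i hi).1
      · rw [hroot _ (by simp)]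
        have h2 := h j
        rw [if_pos rfl, hGj] at h2
        have h3 : ∑ i ∈ Finset.univ.erase j, x i =
            (∑ i ∈ Finset.univ.erase j,
              (Function.update k j 0 i : ℂ) * (b : ℂ) ^ (i : ℕ)) * x j := by
          rw [Finset.sum_mul]
          refine Finset.sum_congr rfl fun i hi => ?_
          rw [(hk i (Finset.ne_of_mem_erase hi)).2,
            Function.update_of_ne (Finset.ne_of_mem_erase hi)]
        rw [h3, mul_assoc, mul_pow_sub_one (hd j).ne', ← neg_mul, ← add_mul] at h2
        have h4 := (mul_eq_zero.1 h2).resolve_right (pow_ne_zero _ hxj)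
        linear_combination h4
    · rintro ⟨f, hf, rfl⟩
      rw [mem_boxExcept] at hf
      refine ⟨fun i => if i = j then 1 else (f i : ℂ) * (b : ℂ) ^ (i : ℕ), ?_, fun i => ?_⟩
      · exact fun h => by simpa using congrFun h j
      · rw [hform]
        by_cases hi : i = j
        · subst hi
          rw [hGj, if_pos rfl, hroot f hf.1]
          simp only [if_true, one_pow, mul_one]
          rw [Finset.sum_congr rfl fun k hk => if_neg (Finset.ne_of_mem_erase hk)]
          ring
        · rw [if_neg hi, add_zero, hGne _ _ hi]
          exact ⟨f i, hf.2 i hi, by simp [hi]⟩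
  have hinj : Set.InjOn root (boxExcept d j) := by
    have hlt : ∀ f ∈ boxExcept d j, ∀ i, f i < b := by
      intro f hf i
      rw [mem_boxExcept] at hf
      by_cases hi : i = j
      · rw [hi, hf.1]; omega
      · exact (hf.2 i hi).trans (hdb i)
    intro f hf f' hf' h
    have h1 := (finFunctionFinEquiv (m := b) (n := m)).injective (a₁ := fun i => ⟨f i, hlt f hf i⟩)
      (a₂ := fun i => ⟨f' i, hlt f' hf' i⟩)
      (Fin.ext (by simpa [finFunctionFinEquiv_apply, root] using h))
    exact funext fun i => congrArg Fin.val (congrFun h1 i)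
  have hq0 : q ≠ 0 := by
    intro h0
    have h1 : ∀ s : ℂ, s ∈ ((boxExcept d j).image fun f => ((root f : ℕ) : ℂ)) := by
      intro s
      obtain ⟨f, hf, hs⟩ := (hmem s).1 (by rw [h0, Polynomial.eval_zero])
      exact Finset.mem_image.2 ⟨f, hf, hs.symm⟩
    exact Set.infinite_univ (Set.Finite.subset (Finset.finite_toSet _) fun s _ => h1 s)
  have hcard : ((boxExcept d j).image fun f => ((root f : ℕ) : ℂ)).card =
      ∏ i ∈ Finset.univ.erase j, d i := by
    rw [← card_boxExcept, Finset.card_image_of_injOn]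
    intro f hf f' hf' h
    exact hinj hf hf' (Nat.cast_injective h)
  rw [← hcard]
  refine (Polynomial.card_le_degree_of_subset_roots ?_).trans hq
  intro s hs
  rw [Finset.mem_val, Finset.mem_image] at hs
  obtain ⟨f, hf, rfl⟩ := hs
  rw [Polynomial.mem_roots hq0]
  exact (hmem _).2 ⟨f, hf, rfl⟩

theorem IsComplexResultant.exists_det_eq_mul {p : MvPolynomial (CoeffIdx m d) ℂ}
    (hp : IsComplexResultant p) (hd : ∀ i, 0 < d i) (j : Fin m) {c : Mono m t → Fin m}
    (hc : ∀ α, d (c α) ≤ α.1 (c α)) (hcj : ∀ α, c α = j → ∀ i ≠ j, α.1 i < d i) :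
    ∃ E, (macaulayOf c X).det = p * E ∧ IsWeightedHomogeneous (formWeight j) E 0 ∧
      IsWeightedHomogeneous (formWeight j) p (∏ i ∈ Finset.univ.erase j, d i) := by
  obtain ⟨E, hE⟩ : p ∣ (macaulayOf c X).det := hp.prime.dvd_of_eval_eq_zero fun u hu => by
    rw [eval_det_macaulayOf]
    exact det_macaulayOf_eq_zero hc ((hp.eval_eq_zero_iff u).1 hu)
  have h0 : p * E ≠ 0 := by
    rw [← hE]
    intro h0
    have := eval_det_macaulayOf c (powSystem ℂ d)
    rw [h0, det_macaulayOf_powSystem, map_zero] at this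
    exact zero_ne_one this
  have hhom := isWeightedHomogeneous_det_macaulayOf (A := ℂ) (d := d) c j
  rw [hE] at hhom
  obtain ⟨a, b, hab, ha, hb⟩ := exists_isWeightedHomogeneous_of_mul hhom h0
  have h1 := hp.le_degree hd j ha
  have h2 : (Finset.univ.filter fun α => c α = j).card ≤ ∏ i ∈ Finset.univ.erase j, d i :=
    card_filter_lt_le j fun α hα => hcj α (Finset.mem_filter.1 hα).2
  obtain rfl : b = 0 := by omega
  obtain rfl : a = ∏ i ∈ Finset.univ.erase j, d i := by omega
  exact ⟨E, hE, hb, ha⟩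

theorem IsComplexResultant.isWeightedHomogeneous {p : MvPolynomial (CoeffIdx m d) ℂ}
    (hp : IsComplexResultant p) (hd : ∀ i, 0 < d i) (j : Fin m) :
    IsWeightedHomogeneous (formWeight j) p (∏ i ∈ Finset.univ.erase j, d i) := by
  obtain ⟨c, hc, hcj⟩ := exists_choice_last (Nat.lt_succ_self (∑ i, (d i - 1))) j
  obtain ⟨-, -, -, h⟩ := hp.exists_det_eq_mul hd j hc hcj
  exact h

end Degree

section Irreducible

variable {A : Type*} [CommRing A] {m : ℕ} {d : Fin m → ℕ}

/-- The system `H i (x) * G i - G i (x) * H i`, which vanishes at `x`. -/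
def vanishingSystem (H G : CoeffIdx m d → A) (x : Fin m → A) : CoeffIdx m d → A :=
  fun v => formEval H x v.1 * G v - formEval G x v.1 * H v

theorem formEval_vanishingSystem (H G : CoeffIdx m d → A) (x : Fin m → A) (i : Fin m) :
    formEval (vanishingSystem H G x) x i = 0 := by
  have h : formEval (vanishingSystem H G x) x i =
      formEval H x i * formEval G x i - formEval G x i * formEval H x i := by
    conv_rhs => rw [formEval.eq_def G, formEval.eq_def H]
    rw [formEval, Finset.mul_sum, Finset.mul_sum, ← Finset.sum_sub_distrib]
    refine Finset.sum_congr rfl fun γ _ => ?_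
    simp only [vanishingSystem, formEval]
    ring
  rw [h, mul_comm, sub_self]

theorem exists_vanishingSystem_eq {u : CoeffIdx m d → ℂ} {x : Fin m → ℂ} (hx : x ≠ 0)
    (hu : ∀ i, formEval u x i = 0) : ∃ H, vanishingSystem H u x = u := by
  obtain ⟨j, hj⟩ := Function.ne_iff.1 hx
  refine ⟨fun v => if v.2 = purePow j (d v.1) then (x j ^ d v.1)⁻¹ else 0, ?_⟩
  funext v
  rw [vanishingSystem, hu, zero_mul, sub_zero]
  have h : formEval (fun v : CoeffIdx m d =>
      if v.2 = purePow j (d v.1) then (x j ^ d v.1)⁻¹ else 0) x v.1 = 1 := by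
    rw [formEval, Finset.sum_eq_single (purePow j (d v.1))]
    · rw [if_pos rfl, Finset.prod_eq_single j]
      · simpa [purePow] using inv_mul_cancel₀ (pow_ne_zero _ hj)
      · simp +contextual [purePow]
      · simp
    · intro γ _ hγ
      simp [hγ]
    · simp
  rw [h, one_mul]

theorem map_vanishingSystem {B : Type*} [CommRing B] (φ : A →+* B) (H G : CoeffIdx m d → A)
    (x : Fin m → A) (v : CoeffIdx m d) :
    φ (vanishingSystem H G x v) =
      vanishingSystem (fun v => φ (H v)) (fun v => φ (G v)) (fun j => φ (x j)) v := by
  simp [vanishingSystem, formEval]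

theorem eval_eq_zero_or_of_hasZero (hm : 0 < m) (f g : MvPolynomial (CoeffIdx m d) ℂ)
    (h : ∀ u ∈ {u | HasZero u}, eval u (f * g) = 0) :
    (∀ u ∈ {u | HasZero u}, eval u f = 0) ∨ ∀ u ∈ {u | HasZero u}, eval u g = 0 := by
  let τ := Fin m ⊕ (CoeffIdx m d ⊕ CoeffIdx m d)
  let Φ : CoeffIdx m d → MvPolynomial τ ℂ := vanishingSystem
    (fun v => X (Sum.inr (Sum.inl v))) (fun v => X (Sum.inr (Sum.inr v))) (fun j => X (Sum.inl j))
  have hΦ : ∀ (y : τ → ℂ) (f : MvPolynomial (CoeffIdx m d) ℂ), eval y (aeval Φ f) =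
      eval (vanishingSystem (fun v => y (Sum.inr (Sum.inl v)))
        (fun v => y (Sum.inr (Sum.inr v))) (fun j => y (Sum.inl j))) f := by
    intro y f
    have h := MvPolynomial.comp_aeval_apply (f := Φ) (aeval (R := ℂ) y) f
    simp only [aeval_eq_eval] at h
    rw [h]
    congr 2
    funext v
    rw [map_vanishingSystem]
    simp only [eval_X]
  have hvan : ∀ f : MvPolynomial (CoeffIdx m d) ℂ, aeval Φ f = 0 →
      ∀ u ∈ {u | HasZero u}, eval u f = 0 := by
    rintro f hf u ⟨x, hx, hu⟩
    obtain ⟨H, hH⟩ := exists_vanishingSystem_eq hx hu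
    have h1 := hΦ (Sum.elim x (Sum.elim H u)) f
    rw [hf, map_zero] at h1
    simp only [Sum.elim_inl, Sum.elim_inr] at h1
    rw [← hH, ← h1]
  have hprod : (X (Sum.inl ⟨0, hm⟩) : MvPolynomial τ ℂ) * (aeval Φ f * aeval Φ g) = 0 := by
    refine MvPolynomial.funext fun y => ?_
    rw [← map_mul, map_mul, hΦ, map_zero, eval_X, mul_eq_zero, or_iff_not_imp_left]
    intro hy
    refine h _ ⟨fun j => y (Sum.inl j), fun h0 => hy (congrFun h0 _), fun i => ?_⟩
    exact formEval_vanishingSystem _ _ _ i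
  rcases mul_eq_zero.1 ((mul_eq_zero.1 hprod).resolve_left (X_ne_zero _)) with h0 | h0
  · exact Or.inl (hvan f h0)
  · exact Or.inr (hvan g h0)

end Irreducible

section SetLast

variable {A : Type*} [CommRing A] {m : ℕ} {d : Fin (m + 1) → ℕ}

/-- The monomial obtained by multiplying by the `k`-th power of a new last variable. -/
def Mono.snoc {e t : ℕ} (k : ℕ) (h : e + k = t) (γ : Mono m e) : Mono (m + 1) t :=
  ⟨Fin.snoc (α := fun _ => ℕ) γ.1 k, by rw [Fin.sum_snoc, γ.2, h]⟩

theorem Mono.snoc_castSucc {e t k : ℕ} (h : e + k = t) (γ : Mono m e) (i : Fin m) :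
    (Mono.snoc k h γ).1 i.castSucc = γ.1 i := by
  simp [Mono.snoc]

theorem Mono.snoc_last {e t k : ℕ} (h : e + k = t) (γ : Mono m e) :
    (Mono.snoc k h γ).1 (Fin.last m) = k := by
  simp [Mono.snoc]

theorem Mono.snoc_injective {e t k : ℕ} (h : e + k = t) :
    Function.Injective (Mono.snoc k h : Mono m e → Mono (m + 1) t) := by
  intro a b hab
  ext i
  rw [← Mono.snoc_castSucc h a, hab, Mono.snoc_castSucc]

theorem Mono.exists_snoc_eq {e t k : ℕ} (h : e + k = t) (γ : Mono (m + 1) t)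
    (hγ : γ.1 (Fin.last m) = k) : ∃ γ' : Mono m e, Mono.snoc k h γ' = γ := by
  have h1 := γ.2
  rw [Fin.sum_univ_castSucc, hγ] at h1
  have h2 : ∑ i : Fin m, γ.1 i.castSucc = e := by omega
  refine ⟨⟨fun i => γ.1 i.castSucc, h2⟩, Subtype.ext (funext fun i => ?_)⟩
  induction i using Fin.lastCases with
  | last => rw [Mono.snoc_last, hγ]
  | cast i => rw [Mono.snoc_castSucc]

theorem sum_mono_eq_sum_snoc {e : ℕ} {g : Mono (m + 1) e → A}
    (hg : ∀ γ, γ.1 (Fin.last m) ≠ 0 → g γ = 0) :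
    ∑ γ, g γ = ∑ γ : Mono m e, g (Mono.snoc 0 rfl γ) := by
  symm
  refine Fintype.sum_of_injective _ (Mono.snoc_injective rfl) _ _ (fun γ hγ => hg γ fun h0 => ?_)
    fun _ => rfl
  exact hγ (Mono.exists_snoc_eq rfl γ h0)

/-- Coefficients of forms not involving the last variable. -/
def initIdx (d : Fin (m + 1) → ℕ) (v : CoeffIdx m fun i => d i.castSucc) :
    CoeffIdx (m + 1) d :=
  ⟨v.1.castSucc, Mono.snoc 0 rfl v.2⟩

theorem initIdx_injective : Function.Injective (initIdx d) := by
  rintro ⟨i, γ⟩ ⟨i', γ'⟩ h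
  obtain rfl : i = i' := Fin.castSucc_injective m (congrArg Sigma.fst h)
  obtain rfl : γ = γ' := Mono.snoc_injective rfl (eq_of_heq (Sigma.mk.inj h).2)
  rfl

/-- Replace the last form by the power `x_last ^ d_last`. -/
def setLast (u : CoeffIdx (m + 1) d → A) : CoeffIdx (m + 1) d → A :=
  fun v => if v.1 = Fin.last m then powSystem A d v else u v

theorem map_setLast {B : Type*} [CommRing B] (φ : A →+* B) (u : CoeffIdx (m + 1) d → A)
    (v : CoeffIdx (m + 1) d) : φ (setLast u v) = setLast (fun v => φ (u v)) v := by
  simp only [setLast, powSystem, apply_ite φ, map_one, map_zero]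

theorem powSystem_comp_initIdx :
    powSystem A d ∘ initIdx d = powSystem A (fun i => d i.castSucc) := by
  funext v
  have h : Mono.snoc 0 rfl v.2 = purePow v.1.castSucc (d v.1.castSucc) ↔
      v.2 = purePow v.1 (d v.1.castSucc) := by
    have h1 : purePow v.1.castSucc (d v.1.castSucc) =
        Mono.snoc 0 rfl (purePow v.1 (d v.1.castSucc)) := by
      refine Subtype.ext (funext fun i => ?_)
      induction i using Fin.lastCases with
      | last => rw [Mono.snoc_last]; simp [purePow, (Fin.castSucc_lt_last v.1).ne']
      | cast i => rw [Mono.snoc_castSucc]; simp [purePow, Pi.single_apply]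
    rw [h1, (Mono.snoc_injective rfl).eq_iff]
  simp only [Function.comp_apply, powSystem, initIdx, h]

theorem formEval_setLast_last (u : CoeffIdx (m + 1) d → A) (x : Fin (m + 1) → A) :
    formEval (setLast u) x (Fin.last m) = x (Fin.last m) ^ d (Fin.last m) := by
  rw [← formEval_powSystem]
  simp [formEval, setLast]

theorem formEval_setLast_castSucc (u : CoeffIdx (m + 1) d → A) {x : Fin (m + 1) → A}
    (hx : x (Fin.last m) = 0) (i : Fin m) :
    formEval (setLast u) x i.castSucc =
      formEval (u ∘ initIdx d) (fun j => x j.castSucc) i := by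
  rw [formEval, sum_mono_eq_sum_snoc, formEval]
  · refine Finset.sum_congr rfl fun γ _ => ?_
    rw [Fin.prod_univ_castSucc]
    simp [setLast, initIdx, Mono.snoc_castSucc, Mono.snoc_last, (Fin.castSucc_lt_last i).ne]
  · intro γ hγ
    rw [Finset.prod_eq_zero (Finset.mem_univ (Fin.last m)), mul_zero]
    rw [hx, zero_pow hγ]

theorem hasZero_setLast_iff (hd : ∀ i, 0 < d i) (u : CoeffIdx (m + 1) d → ℂ) :
    HasZero (setLast u) ↔ HasZero (u ∘ initIdx d) := by
  constructor
  · rintro ⟨x, hx, h⟩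
    have h0 : x (Fin.last m) = 0 := by
      have := h (Fin.last m)
      rw [formEval_setLast_last] at this
      exact (pow_eq_zero_iff (hd _).ne').1 this
    refine ⟨fun j => x j.castSucc, fun h1 => hx (funext fun j => ?_), fun i => ?_⟩
    · induction j using Fin.lastCases with
      | last => exact h0
      | cast j => exact congrFun h1 j
    · rw [← formEval_setLast_castSucc u h0, h]
  · rintro ⟨x, hx, h⟩
    have hl : (Fin.snoc (α := fun _ => ℂ) x 0 : Fin (m + 1) → ℂ) (Fin.last m) = 0 := by simp
    refine ⟨Fin.snoc (α := fun _ => ℂ) x 0, fun h1 => hx (funext fun j => ?_), fun i => ?_⟩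
    · simpa using congrFun h1 j.castSucc
    · induction i using Fin.lastCases with
      | last => rw [formEval_setLast_last, hl, zero_pow (hd _).ne']
      | cast i => rw [formEval_setLast_castSucc u hl]; simpa using h i

theorem prime_rename_of_injective {σ τ : Type*} {f : σ → τ} (hf : Function.Injective f)
    {p : MvPolynomial σ ℂ} (hp : Prime p) : Prime (rename f p) := by
  have h : rename f p =
      rename (Subtype.val : Set.range f → τ) (renameEquiv ℂ (Equiv.ofInjective f hf) p) := by
    rw [renameEquiv_apply, rename_rename]
    rfl
  rw [h, prime_rename_iff, MulEquiv.prime_iff]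
  exact hp

theorem not_hasZero_powSystem {m : ℕ} {d : Fin m → ℕ} (hd : ∀ i, 0 < d i) :
    ¬ HasZero (powSystem ℂ d) := by
  rintro ⟨x, hx, h⟩
  refine hx (funext fun i => ?_)
  have := h i
  rw [formEval_powSystem] at this
  exact (pow_eq_zero_iff (hd i).ne').1 this

theorem setLast_powSystem : setLast (powSystem A d) = powSystem A d := by
  funext v
  rw [setLast, ite_self]

theorem eval_aeval_setLast {σ : Type*} (w : CoeffIdx (m + 1) d → MvPolynomial σ ℂ) (y : σ → ℂ)
    (p : MvPolynomial (CoeffIdx (m + 1) d) ℂ) :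
    eval y (aeval (setLast w) p) = eval (setLast fun v => eval y (w v)) p := by
  have h := MvPolynomial.comp_aeval_apply (f := setLast w) (aeval (R := ℂ) y) p
  simp only [aeval_eq_eval] at h
  rw [h]
  congr 2
  funext v
  rw [map_setLast]

theorem IsComplexResultant.exists_init (hm : 0 < m) (hd : ∀ i, 0 < d i)
    {p : MvPolynomial (CoeffIdx (m + 1) d) ℂ} (hp : IsComplexResultant p) :
    ∃ q : MvPolynomial (CoeffIdx m fun i => d i.castSucc) ℂ, IsComplexResultant q := by
  have hd' : ∀ i : Fin m, 0 < d i.castSucc := fun i => hd _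
  let w : CoeffIdx (m + 1) d → MvPolynomial (CoeffIdx m fun i => d i.castSucc) ℂ :=
    Function.extend (initIdx d) X 0
  let r := aeval (setLast w) p
  have hr : ∀ u, eval u r = 0 ↔ HasZero u := by
    intro u
    rw [eval_aeval_setLast, hp.eval_eq_zero_iff, hasZero_setLast_iff hd]
    have : (fun v => eval u (w v)) ∘ initIdx d = u := by
      funext v
      simp [w, initIdx_injective.extend_apply]
    rw [this]
  have hr0 : r ≠ 0 := fun h0 => not_hasZero_powSystem hd' <| by rw [← hr, h0, map_zero]
  obtain ⟨q, hq, ⟨s, hqr⟩, hqZ⟩ := exists_prime_dvd_of_vanishing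
    (Z := {u : CoeffIdx m (fun i => d i.castSucc) → ℂ | HasZero u})
    ⟨0, fun _ => 1, fun h => one_ne_zero (congrFun h ⟨0, hm⟩), fun i => by simp [formEval]⟩
    (eval_eq_zero_or_of_hasZero hm) hr0 fun u hu => (hr u).2 hu
  have hqz : ∀ u, eval u q = 0 ↔ HasZero u :=
    fun u => ⟨fun h => (hr u).1 (by rw [hqr, map_mul, h, zero_mul]), fun h => hqZ u h⟩
  have h1 : eval (powSystem ℂ fun i : Fin m => d i.castSucc) q ≠ 0 :=
    fun h => not_hasZero_powSystem hd' ((hqz _).1 h)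
  have hu : IsUnit (C (eval (powSystem ℂ fun i : Fin m => d i.castSucc) q)⁻¹ :
      MvPolynomial (CoeffIdx m fun i => d i.castSucc) ℂ) :=
    (isUnit_iff_ne_zero.2 (inv_ne_zero h1)).map C
  refine ⟨C (eval (powSystem ℂ fun i : Fin m => d i.castSucc) q)⁻¹ * q, ?_, fun u => ?_, ?_⟩
  · exact (associated_isUnit_mul_left_iff hu |>.2 (Associated.refl q)).symm.prime hq
  · rw [map_mul, eval_C, mul_eq_zero, or_iff_right (inv_ne_zero h1), hqz]
  · rw [map_mul, eval_C, inv_mul_cancel₀ h1]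

theorem IsComplexResultant.eval_setLast (hm : 0 < m) (hd : ∀ i, 0 < d i)
    {p : MvPolynomial (CoeffIdx (m + 1) d) ℂ} (hp : IsComplexResultant p)
    {q : MvPolynomial (CoeffIdx m fun i => d i.castSucc) ℂ} (hq : IsComplexResultant q)
    (u : CoeffIdx (m + 1) d → ℂ) :
    eval (setLast u) p = eval (u ∘ initIdx d) q ^ d (Fin.last m) := by
  obtain ⟨a, k, hr⟩ := (prime_rename_of_injective initIdx_injective hq.prime
    ).eq_C_mul_pow_of_eval_eq_zero (f := aeval (setLast X) p) fun u hu => by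
      rw [eval_aeval_setLast] at hu
      simp only [eval_X] at hu
      rw [eval_rename, hq.eval_eq_zero_iff, ← hasZero_setLast_iff hd, ← hp.eval_eq_zero_iff, hu]
  have hev : ∀ u, eval (setLast u) p = a * eval (u ∘ initIdx d) q ^ k := by
    intro u
    have := congrArg (eval u) hr
    rw [eval_aeval_setLast, map_mul, map_pow, eval_C, eval_rename] at this
    simpa only [eval_X] using this
  obtain rfl : a = 1 := by
    have := hev (powSystem ℂ d)
    rw [setLast_powSystem, powSystem_comp_initIdx, hp.eval_powSystem, hq.eval_powSystem] at this
    simpa using this.symm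
  have hd' : ∀ i : Fin m, 0 < d i.castSucc := fun i => hd _
  let j : Fin m := ⟨0, hm⟩
  have hk : ∏ i ∈ Finset.univ.erase j.castSucc, d i =
      (∏ i ∈ Finset.univ.erase j, d i.castSucc) * k := by
    have h1 := hev fun v => 2 ^ formWeight j.castSucc v * powSystem ℂ d v
    have h2 : setLast (fun v => 2 ^ formWeight j.castSucc v * powSystem ℂ d v) =
        fun v => 2 ^ formWeight j.castSucc v * powSystem ℂ d v := by
      funext v
      by_cases hv : v.1 = Fin.last m
      · simp [setLast, hv, formWeight, (Fin.castSucc_lt_last j).ne']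
      · simp [setLast, hv]
    have h3 : (fun v => 2 ^ formWeight j.castSucc v * powSystem ℂ d v) ∘ initIdx d =
        fun v => 2 ^ formWeight j v * powSystem ℂ (fun i => d i.castSucc) v := by
      funext v
      rw [← powSystem_comp_initIdx]
      simp [formWeight, initIdx]
    rw [h2, h3, (hp.isWeightedHomogeneous hd j.castSucc).eval_pow_mul, hp.eval_powSystem,
      (hq.isWeightedHomogeneous hd' j).eval_pow_mul, hq.eval_powSystem, mul_one, mul_one, one_mul,
      ← pow_mul] at h1
    exact Nat.pow_right_injective le_rfl (by exact_mod_cast h1)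
  have hdl : ∏ i ∈ Finset.univ.erase j.castSucc, d i =
      (∏ i ∈ Finset.univ.erase j, d i.castSucc) * d (Fin.last m) := by
    have h1 := Finset.mul_prod_erase Finset.univ d (Finset.mem_univ j.castSucc)
    rw [Fin.prod_univ_castSucc,
      ← Finset.mul_prod_erase Finset.univ (fun i : Fin m => d i.castSucc) (Finset.mem_univ j),
      mul_assoc] at h1
    exact Nat.eq_of_mul_eq_mul_left (hd _) h1
  have hpos : 0 < ∏ i ∈ Finset.univ.erase j, d i.castSucc := Finset.prod_pos fun i _ => hd _
  rw [hev, one_mul, Nat.eq_of_mul_eq_mul_left hpos (hk.symm.trans hdl)]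

end SetLast

section MinIdx

variable {n t : ℕ} {d : Fin (n + 1) → ℕ}

theorem mem_divisorSet {m : ℕ} {d : Fin m → ℕ} {α : Mono m t} {i : Fin m} :
    i ∈ divisorSet d α ↔ d i ≤ α.1 i := by
  simp [divisorSet]

theorem minIdx_eq {α : Mono (n + 1) t} {i : Fin (n + 1)} (h : d i ≤ α.1 i)
    (hlt : ∀ j < i, α.1 j < d j) : minIdx d α = i := by
  have hne : (divisorSet d α).Nonempty := ⟨i, mem_divisorSet.2 h⟩
  rw [minIdx, dif_pos hne]
  refine le_antisymm (Finset.min'_le _ _ (mem_divisorSet.2 h)) (Finset.le_min' _ _ _ fun j hj => ?_)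
  by_contra! hji
  exact absurd (mem_divisorSet.1 hj) (hlt j hji).not_ge

theorem le_apply_minIdx {α : Mono (n + 1) t} (h : ∃ i, d i ≤ α.1 i) :
    d (minIdx d α) ≤ α.1 (minIdx d α) := by
  have hne : (divisorSet d α).Nonempty := h.imp fun i hi => mem_divisorSet.2 hi
  rw [minIdx, dif_pos hne]
  exact mem_divisorSet.1 (Finset.min'_mem _ hne)

theorem apply_lt_of_lt_minIdx {α : Mono (n + 1) t} {j : Fin (n + 1)} (h : j < minIdx d α) :
    α.1 j < d j := by
  by_contra! hj
  have hne : (divisorSet d α).Nonempty := ⟨j, mem_divisorSet.2 hj⟩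
  rw [minIdx, dif_pos hne] at h
  exact h.not_ge (Finset.min'_le _ _ (mem_divisorSet.2 hj))

theorem isReducedMono_of_minIdx_eq_last {α : Mono (n + 1) t} (h : ∃ i, d i ≤ α.1 i)
    (hα : minIdx d α = Fin.last n) : IsReducedMono d α := by
  refine Finset.card_eq_one.2
    ⟨Fin.last n, Finset.eq_singleton_iff_unique_mem.2 ⟨?_, fun j hj => ?_⟩⟩
  · rw [mem_divisorSet, ← hα]
    exact le_apply_minIdx h
  · by_contra hne
    rw [mem_divisorSet] at hj
    exact (apply_lt_of_lt_minIdx (hα ▸ Fin.lt_last_iff_ne_last.2 hne)).not_ge hj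

theorem IsReducedMono.minIdx_eq {α : Mono (n + 1) t} (h : IsReducedMono d α) {i : Fin (n + 1)}
    (hi : d i ≤ α.1 i) : minIdx d α = i :=
  Finset.card_le_one.1 h.le _ (mem_divisorSet.2 (le_apply_minIdx ⟨i, hi⟩)) _ (mem_divisorSet.2 hi)

theorem minIdx_snoc {d : Fin (n + 2) → ℕ} {e k : ℕ} (h : e + k = t) {α : Mono (n + 1) e}
    (hα : ∃ i : Fin (n + 1), d i.castSucc ≤ α.1 i) :
    minIdx d (Mono.snoc k h α) = (minIdx (fun i => d i.castSucc) α).castSucc := by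
  refine _root_.minIdx_eq ?_ fun j hj => ?_
  · rw [Mono.snoc_castSucc]
    exact le_apply_minIdx (d := fun i => d i.castSucc) hα
  · induction j using Fin.lastCases with
    | last => exact absurd hj (Fin.le_last _).not_gt
    | cast j =>
      rw [Mono.snoc_castSucc]
      exact apply_lt_of_lt_minIdx (d := fun i => d i.castSucc) (Fin.castSucc_lt_castSucc_iff.1 hj)

theorem isReducedMono_snoc_iff {d : Fin (n + 2) → ℕ} {e k : ℕ} (h : e + k = t)
    (hk : k < d (Fin.last (n + 1))) (α : Mono (n + 1) e) :
    IsReducedMono d (Mono.snoc k h α) ↔ IsReducedMono (fun i => d i.castSucc) α := by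
  have : divisorSet d (Mono.snoc k h α) =
      (divisorSet (fun i => d i.castSucc) α).map Fin.castSuccEmb := by
    ext i
    rw [mem_divisorSet, Finset.mem_map]
    induction i using Fin.lastCases with
    | last => simp [Mono.snoc_last, hk, (Fin.castSucc_lt_last _).ne]
    | cast i => simp [Mono.snoc_castSucc, mem_divisorSet]
  rw [IsReducedMono, IsReducedMono, this, Finset.card_map]

end MinIdx

section SetLastEntries

variable {A : Type*} [CommRing A] {m t : ℕ} {d : Fin (m + 1) → ℕ}

theorem macaulayEntry_setLast_last (u : CoeffIdx (m + 1) d → A) (α β : Mono (m + 1) t) :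
    macaulayEntry (setLast u) (Fin.last m) α β = if α = β then 1 else 0 := by
  rw [← macaulayEntry_powSystem (d := d) (Fin.last m)]
  simp [macaulayEntry, setLast]

theorem macaulayEntry_setLast_of_ne (u : CoeffIdx (m + 1) d → A) {i : Fin (m + 1)}
    (hi : i ≠ Fin.last m) (α β : Mono (m + 1) t) :
    macaulayEntry (setLast u) i α β = macaulayEntry u i α β := by
  simp [macaulayEntry, setLast, hi]

theorem macaulayEntry_setLast_eq_zero (u : CoeffIdx (m + 1) d → A) (i : Fin (m + 1))
    {α β : Mono (m + 1) t} (h : β.1 (Fin.last m) < α.1 (Fin.last m)) :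
    macaulayEntry (setLast u) i α β = 0 := by
  by_cases hi : i = Fin.last m
  · subst hi
    rw [macaulayEntry_setLast_last, if_neg]
    rintro rfl
    exact h.false
  · refine Finset.sum_eq_zero fun γ _ => if_neg fun hc => ?_
    have := congrFun hc (Fin.last m)
    simp only [Pi.add_apply, Pi.single_eq_of_ne (Ne.symm hi)] at this
    omega

theorem macaulayEntry_setLast_snoc (u : CoeffIdx (m + 1) d → A) {e k : ℕ} (h : e + k = t)
    (i : Fin m) (α β : Mono m e) :
    macaulayEntry (setLast u) i.castSucc (Mono.snoc k h α) (Mono.snoc k h β) =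
      macaulayEntry (u ∘ initIdx d) i α β := by
  rw [macaulayEntry_setLast_of_ne u (Fin.castSucc_lt_last i).ne, macaulayEntry,
    sum_mono_eq_sum_snoc, macaulayEntry]
  · refine Finset.sum_congr rfl fun γ _ => ?_
    have : (Mono.snoc k h β).1 + Pi.single i.castSucc (d i.castSucc) =
        (Mono.snoc k h α).1 + (Mono.snoc 0 rfl γ).1 ↔
        β.1 + Pi.single i (d i.castSucc) = α.1 + γ.1 := by
      simp only [funext_iff, Fin.forall_fin_succ', Pi.add_apply, Mono.snoc_castSucc,
        Mono.snoc_last]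
      simp [Pi.single_apply, (Fin.castSucc_lt_last i).ne']
    simp only [this, Function.comp_apply, initIdx]
  · intro γ hγ
    refine if_neg fun hc => hγ ?_
    have := congrFun hc (Fin.last m)
    simpa [Mono.snoc_last, Pi.single_apply, (Fin.castSucc_lt_last i).ne'] using this

end SetLastEntries

section Blocks

variable {A : Type*} [CommRing A]

theorem det_submatrix_of_bijective {ι κ : Type*} [Fintype ι] [DecidableEq ι] [Fintype κ]
    [DecidableEq κ] (M : Matrix ι ι A) {f : κ → ι} (hf : Function.Bijective f) :
    (M.submatrix f f).det = M.det :=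
  Matrix.det_submatrix_equiv_self (Equiv.ofBijective f hf) M

theorem det_eq_det_of_unit_rows {ι : Type*} [Fintype ι] [DecidableEq ι] (M : Matrix ι ι A)
    (P : ι → Prop) [DecidablePred P] (h : ∀ i, P i → ∀ j, M i j = if i = j then 1 else 0) :
    M.det = (M.submatrix (Subtype.val : {i // ¬ P i} → ι) Subtype.val).det := by
  rw [Matrix.twoBlockTriangular_det' M P]
  · have : M.toSquareBlockProp P = 1 := by
      ext i j
      rw [Matrix.toSquareBlockProp_def, Matrix.of_apply, h _ i.2, Matrix.one_apply]
      simp only [Subtype.ext_iff]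
    rw [this, Matrix.det_one, one_mul]
    rfl
  · intro i hi j hj
    rw [h i hi, if_neg]
    rintro rfl
    exact hj hi

variable {m t : ℕ} {d : Fin (m + 1) → ℕ}

/-- The exponent of the last variable. -/
def lastExp (α : Mono (m + 1) t) : Fin (t + 1) :=
  ⟨α.1 (Fin.last m), Nat.lt_succ_of_le <|
    (Finset.single_le_sum (fun _ _ => Nat.zero_le _) (Finset.mem_univ _)).trans α.2.le⟩

theorem det_macaulayOf_setLast_submatrix {ι : Type*} [Fintype ι] [DecidableEq ι]
    (e : ι → Mono (m + 1) t) (c : Mono (m + 1) t → Fin (m + 1)) (u : CoeffIdx (m + 1) d → A) :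
    ((macaulayOf c (setLast u)).submatrix e e).det =
      ∏ k, (((macaulayOf c (setLast u)).submatrix e e).toSquareBlock
        (fun x => lastExp (e x)) k).det :=
  Matrix.BlockTriangular.det_fintype fun x _ h => macaulayEntry_setLast_eq_zero u (c (e x)) h

end Blocks

/-- The minor of the Macaulay matrix on the non-reduced monomials. -/
noncomputable def macaulayMinor {A : Type*} [CommRing A] {n : ℕ} (d : Fin (n + 1) → ℕ) (t : ℕ)
    (u : CoeffIdx (n + 1) d → A) : A :=
  ((macaulayOf (minIdx d) u).submatrix
    (Subtype.val : {α : Mono (n + 1) t // ¬ IsReducedMono d α} → Mono (n + 1) t)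
    Subtype.val).det

section Induction

variable {n t : ℕ}

theorem macaulayMinor_setLast {A : Type*} [CommRing A] {d : Fin (n + 1) → ℕ}
    (ht : ∑ i, (d i - 1) < t) (u : CoeffIdx (n + 1) d → A) :
    macaulayMinor d t (setLast u) = macaulayMinor d t u := by
  unfold macaulayMinor
  congr 1
  ext α β
  exact macaulayEntry_setLast_of_ne u
    (fun h => α.2 (isReducedMono_of_minIdx_eq_last (exists_le_apply ht _) h)) _ _

theorem det_toSquareBlock_of_lt {A : Type*} [CommRing A] {d : Fin (n + 2) → ℕ}
    (ht : ∑ i, (d i - 1) < t) (u : CoeffIdx (n + 2) d → A) {k : Fin (t + 1)} {e : ℕ}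
    (h : e + k = t) (hk : (k : ℕ) < d (Fin.last (n + 1))) :
    ((macaulayOf (minIdx d) (setLast u)).toSquareBlock lastExp k).det =
        (macaulayOf (t := e) (minIdx fun i => d i.castSucc) (u ∘ initIdx d)).det ∧
      (((macaulayOf (minIdx d) (setLast u)).submatrix
        (Subtype.val : {α : Mono (n + 2) t // ¬ IsReducedMono d α} → Mono (n + 2) t)
        Subtype.val).toSquareBlock (fun x => lastExp x.1) k).det =
        macaulayMinor (fun i => d i.castSucc) e (u ∘ initIdx d) := by
  have he : ∑ i : Fin (n + 1), (d i.castSucc - 1) < e := by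
    rw [Fin.sum_univ_castSucc] at ht
    omega
  have hl : ∀ α : Mono (n + 1) e, lastExp (Mono.snoc k h α) = k := fun α =>
    Fin.ext (Mono.snoc_last h α)
  have hentry : ∀ α β : Mono (n + 1) e,
      macaulayOf (minIdx d) (setLast u) (Mono.snoc k h α) (Mono.snoc k h β) =
        macaulayOf (minIdx fun i => d i.castSucc) (u ∘ initIdx d) α β := by
    intro α β
    rw [macaulayOf, Matrix.of_apply, minIdx_snoc h (exists_le_apply he α),
      macaulayEntry_setLast_snoc]
    rfl
  constructor
  · rw [← det_submatrix_of_bijective _ (f := fun α : Mono (n + 1) e =>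
      (⟨Mono.snoc k h α, hl α⟩ : {α : Mono (n + 2) t // lastExp α = k})) ⟨?_, ?_⟩]
    · congr 1
      ext α β
      exact hentry α β
    · exact fun α β hab => Mono.snoc_injective h (congrArg Subtype.val hab)
    · rintro ⟨α, hα⟩
      obtain ⟨γ, rfl⟩ := Mono.exists_snoc_eq h α (congrArg Fin.val hα)
      exact ⟨γ, rfl⟩
  · rw [← det_submatrix_of_bijective _
      (f := fun α : {α : Mono (n + 1) e // ¬ IsReducedMono (fun i => d i.castSucc) α} =>
        (⟨⟨Mono.snoc k h α.1, fun hr => α.2 ((isReducedMono_snoc_iff h hk α.1).1 hr)⟩, hl α.1⟩ :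
          {x : {α : Mono (n + 2) t // ¬ IsReducedMono d α} // lastExp x.1 = k})) ⟨?_, ?_⟩]
    · unfold macaulayMinor
      congr 1
      ext α β
      exact hentry α.1 β.1
    · exact fun α β hab =>
        Subtype.ext (Mono.snoc_injective h (congrArg (fun x => x.1.1) hab))
    · rintro ⟨⟨α, hr⟩, hα⟩
      obtain ⟨γ, rfl⟩ := Mono.exists_snoc_eq h α (congrArg Fin.val hα)
      exact ⟨⟨γ, fun hγ => hr ((isReducedMono_snoc_iff h hk γ).2 hγ)⟩, rfl⟩

theorem det_toSquareBlock_of_le {A : Type*} [CommRing A] {d : Fin (n + 1) → ℕ}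
    (u : CoeffIdx (n + 1) d → A) {k : Fin (t + 1)} (hk : d (Fin.last n) ≤ k) :
    ((macaulayOf (minIdx d) (setLast u)).toSquareBlock lastExp k).det =
      (((macaulayOf (minIdx d) (setLast u)).submatrix
        (Subtype.val : {α : Mono (n + 1) t // ¬ IsReducedMono d α} → Mono (n + 1) t)
        Subtype.val).toSquareBlock (fun x => lastExp x.1) k).det := by
  rw [det_eq_det_of_unit_rows _ fun x => IsReducedMono d x.1]
  · exact det_submatrix_of_bijective
      (((macaulayOf (minIdx d) (setLast u)).submatrix
        (Subtype.val : {α : Mono (n + 1) t // ¬ IsReducedMono d α} → Mono (n + 1) t)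
        Subtype.val).toSquareBlock (fun x => lastExp x.1) k)
      (f := fun x : {x : {α : Mono (n + 1) t // lastExp α = k} // ¬ IsReducedMono d x.1} =>
        ⟨⟨x.1.1, x.2⟩, x.1.2⟩)
      ⟨fun x y h => Subtype.ext (Subtype.ext (congrArg (fun z => z.1.1) h)),
        fun x => ⟨⟨⟨x.1.1, x.2⟩, x.1.2⟩, rfl⟩⟩
  · rintro ⟨α, hα⟩ hr ⟨β, hβ⟩
    have hlast : minIdx d α = Fin.last n := hr.minIdx_eq (hk.trans_eq (congrArg Fin.val hα).symm)
    simp only [Matrix.toSquareBlock_def, macaulayOf, Matrix.of_apply, hlast,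
      macaulayEntry_setLast_last, Subtype.mk.injEq]

theorem det_macaulayOf_setLast {A : Type*} [CommRing A] {d : Fin (n + 2) → ℕ}
    (ht : ∑ i, (d i - 1) < t) (u : CoeffIdx (n + 2) d → A) {a : A}
    (ha : ∀ e, ∑ i : Fin (n + 1), (d i.castSucc - 1) < e →
      (macaulayOf (t := e) (minIdx fun i => d i.castSucc) (u ∘ initIdx d)).det =
        a * macaulayMinor (fun i => d i.castSucc) e (u ∘ initIdx d)) :
    (macaulayOf (t := t) (minIdx d) (setLast u)).det =
      a ^ d (Fin.last (n + 1)) * macaulayMinor d t u := by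
  have hl : d (Fin.last (n + 1)) ≤ t := by
    rw [Fin.sum_univ_castSucc] at ht
    omega
  have hcard : ∏ k : Fin (t + 1), (if (k : ℕ) < d (Fin.last (n + 1)) then a else 1) =
      a ^ d (Fin.last (n + 1)) := by
    rw [Fin.prod_univ_eq_prod_range (fun k => if k < d (Fin.last (n + 1)) then a else 1),
      Finset.prod_ite, Finset.prod_const_one, mul_one, Finset.prod_const]
    congr 1
    have : (Finset.range (t + 1)).filter (· < d (Fin.last (n + 1))) =
        Finset.range (d (Fin.last (n + 1))) := by
      ext k
      simp only [Finset.mem_filter, Finset.mem_range]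
      omega
    rw [this, Finset.card_range]
  rw [← macaulayMinor_setLast ht, macaulayMinor, det_macaulayOf_setLast_submatrix, ← hcard,
    ← Finset.prod_mul_distrib]
  refine (det_macaulayOf_setLast_submatrix id (minIdx d) u).trans
    (Finset.prod_congr rfl fun k _ => ?_)
  split_ifs with hk
  · have he : t - k + k = t := Nat.sub_add_cancel (Nat.le_of_lt_succ k.2)
    obtain ⟨h1, h2⟩ := det_toSquareBlock_of_lt ht u he hk
    rw [h2, ← ha]
    · exact h1
    · rw [Fin.sum_univ_castSucc] at ht
      omega
  · rw [one_mul]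
    exact det_toSquareBlock_of_le u (not_lt.1 hk)

theorem IsComplexResultant.det_macaulayOf {d : Fin (n + 1) → ℕ} (hd : ∀ i, 0 < d i)
    {p : MvPolynomial (CoeffIdx (n + 1) d) ℂ} (hp : IsComplexResultant p)
    (ht : ∑ i, (d i - 1) < t) (u : CoeffIdx (n + 1) d → ℂ) :
    (macaulayOf (t := t) (minIdx d) u).det = eval u p * macaulayMinor d t u := by
  induction n generalizing t with
  | zero =>
    have : Subsingleton (Fin (0 + 1)) := inferInstanceAs (Subsingleton (Fin 1))
    obtain ⟨E, hE, hE0, -⟩ := hp.exists_det_eq_mul hd (Fin.last 0)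
      (fun α : Mono (0 + 1) t => le_apply_minIdx (exists_le_apply ht α))
      fun α _ i hi => absurd (Subsingleton.elim i _) hi
    have hEu : eval u E = eval (powSystem ℂ d) E := hE0.eval_congr_of_zero fun v hv => by
      simp [formWeight] at hv
      exact absurd (Subsingleton.elim _ _) hv
    have hE1 : eval (powSystem ℂ d) E = 1 := by
      have := eval_det_macaulayOf (minIdx d (δ := t)) (powSystem ℂ d)
      rwa [hE, det_macaulayOf_powSystem, map_mul, hp.eval_powSystem, one_mul] at this
    have : IsEmpty {α : Mono (0 + 1) t // ¬ IsReducedMono d α} :=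
      ⟨fun α => α.2 (isReducedMono_of_minIdx_eq_last (exists_le_apply ht _)
        (Subsingleton.elim _ _))⟩
    have hminor : macaulayMinor d t u = 1 := Matrix.det_isEmpty
    rw [hminor, mul_one, ← eval_det_macaulayOf, hE, map_mul, hEu, hE1,
      mul_one]
  | succ n ih =>
    obtain ⟨E, hE, hE0, -⟩ := hp.exists_det_eq_mul hd (Fin.last (n + 1))
      (fun α : Mono (n + 2) t => le_apply_minIdx (exists_le_apply ht α))
      fun α hα i hi => apply_lt_of_lt_minIdx (hα ▸ Fin.lt_last_iff_ne_last.2 hi)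
    obtain ⟨q, hq⟩ := hp.exists_init n.succ_pos hd
    have hE' : ∀ u, eval u E = eval (setLast u) E := fun u => hE0.eval_congr_of_zero fun v hv => by
      have : v.1 ≠ Fin.last (n + 1) := by simpa [formWeight] using hv
      simp [setLast, this]
    have hmul : rename (initIdx d) q ^ d (Fin.last (n + 1)) * E =
        rename (initIdx d) q ^ d (Fin.last (n + 1)) * macaulayMinor d t X := by
      refine MvPolynomial.funext fun u => ?_
      rw [map_mul, map_mul, map_pow, eval_rename, ← hp.eval_setLast n.succ_pos hd hq, hE',
        ← map_mul, ← hE, eval_det_macaulayOf, hp.eval_setLast n.succ_pos hd hq]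
      rw [macaulayMinor, eval_det_macaulayOf_submatrix]
      exact det_macaulayOf_setLast ht u fun e he => ih (fun i => hd _) hq he _
    have hq0 : rename (initIdx d) q ≠ 0 := fun h0 => hq.prime.ne_zero
      (rename_injective _ initIdx_injective (h0.trans (map_zero _).symm))
    rw [← eval_det_macaulayOf, hE, map_mul, mul_left_cancel₀ (pow_ne_zero _ hq0) hmul,
      macaulayMinor, eval_det_macaulayOf_submatrix]
    rfl

end Induction

theorem resEval_eq_eval {m : ℕ} (d : Fin m → ℕ) (F : Fin m → MvPolynomial (Fin m) ℂ)
    (R : MvPolynomial (CoeffIdx m d) ℤ) :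
    resEval d F R = eval (coeffSystem d F) (map (Int.castRingHom ℂ) R) := by
  rw [eval_map]
  rfl

theorem exists_coeffSystem_eq {m : ℕ} {d : Fin m → ℕ} (u : CoeffIdx m d → ℂ) :
    ∃ F : Fin m → MvPolynomial (Fin m) ℂ, (∀ i, (F i).IsHomogeneous (d i)) ∧
      coeffSystem d F = u := by
  refine ⟨fun i => ∑ γ : Mono m (d i), monomial γ.toFinsupp (u ⟨i, γ⟩),
    fun i => IsHomogeneous.sum _ _ _ fun γ _ => isHomogeneous_monomial _ ?_, ?_⟩
  · rw [Finsupp.degree_eq_sum]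
    exact γ.2
  · funext v
    simp only [coeffSystem, coeff_sum, coeff_monomial, Mono.toFinsupp_injective.eq_iff]
    simp

theorem coeffSystem_X_pow {m : ℕ} (d : Fin m → ℕ) :
    coeffSystem d (fun i => X i ^ d i) = powSystem ℂ d := by
  funext v
  have : Finsupp.single v.1 (d v.1) = (purePow v.1 (d v.1)).toFinsupp := by
    ext j
    simp [purePow, Finsupp.single_apply, Pi.single_apply, eq_comm]
  simp only [coeffSystem, powSystem, coeff_X_pow, this, Mono.toFinsupp_injective.eq_iff, eq_comm]

theorem IsResultant.isComplexResultant {m : ℕ} {d : Fin m → ℕ} {R : MvPolynomial (CoeffIdx m d) ℤ}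
    (hR : IsResultant m d R) : IsComplexResultant (map (Int.castRingHom ℂ) R) := by
  obtain ⟨hzero, -, hirr, hpow⟩ := hR
  refine ⟨hirr.prime, fun u => ?_, ?_⟩
  · obtain ⟨F, hF, rfl⟩ := exists_coeffSystem_eq u
    rw [← resEval_eq_eval, ← hzero F hF]
    simp only [HasZero, formEval_coeffSystem (hF _)]
  · rw [← coeffSystem_X_pow, ← resEval_eq_eval, hpow]

theorem macaulayMatrix_eq_macaulayOf {n δ : ℕ} {d : Fin (n + 1) → ℕ}
    (h : ∑ i, (d i - 1) < δ) (F : Fin (n + 1) → MvPolynomial (Fin (n + 1)) ℂ) :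
    macaulayMatrix d δ F = macaulayOf (minIdx d) (coeffSystem d F) := by
  ext α β
  have hα := le_apply_minIdx (exists_le_apply h α)
  simp only [macaulayMatrix, macaulayOf, Matrix.of_apply]
  generalize minIdx d α = i at hα
  have hle : Finsupp.single i (d i) ≤ α.toFinsupp := Finsupp.single_le_iff.2 hα
  have hadd : ∀ γ : Mono (n + 1) (d i), β.1 + Pi.single i (d i) = α.1 + γ.1 ↔
      β.toFinsupp = α.toFinsupp - Finsupp.single i (d i) + γ.toFinsupp := by
    intro γ
    rw [← add_left_inj (Finsupp.single i (d i)), add_right_comm, tsub_add_cancel_of_le hle,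
      Finsupp.ext_iff, funext_iff]
    simp [Pi.single_apply, Finsupp.single_apply, eq_comm]
  simp only [macaulayEntry, hadd]
  rw [coeff_monomial_mul']
  split_ifs with hβ
  · rw [one_mul]
    have hs : ∑ j, (β.toFinsupp - (α.toFinsupp - Finsupp.single i (d i))) j = d i := by
      have h1 := congrArg Finsupp.degree (tsub_add_cancel_of_le hβ)
      have h2 := congrArg Finsupp.degree (tsub_add_cancel_of_le hle)
      rw [map_add] at h1 h2
      have h3 : Finsupp.degree α.toFinsupp = δ := (Finsupp.degree_eq_sum _).trans α.2
      have h4 : Finsupp.degree β.toFinsupp = δ := (Finsupp.degree_eq_sum _).trans β.2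
      rw [Finsupp.degree_single] at h2
      rw [← Finsupp.degree_eq_sum]
      omega
    have : (Mono.toFinsupp ⟨_, hs⟩ : Fin (n + 1) →₀ ℕ) =
        β.toFinsupp - (α.toFinsupp - Finsupp.single i (d i)) := by ext; rfl
    rw [Finset.sum_eq_single ⟨_, hs⟩]
    · rw [this, if_pos (add_tsub_cancel_of_le hβ).symm, coeffSystem, this]
    · intro γ _ hγ
      refine if_neg fun hc => hγ (Mono.toFinsupp_injective ?_)
      rw [this, hc, add_tsub_cancel_left]
    · simp
  · refine (Finset.sum_eq_zero fun γ _ => if_neg fun hc => hβ ?_).symm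
    rw [hc]
    exact le_self_add

/-- The Macaulay formula: `det 𝔻(F_0,…,F_n) = Res(F_0,…,F_n) ⬝ det 𝔻'(F_0,…,F_n)`, where
`𝔻'` is obtained from `𝔻` by deleting all rows and columns corresponding to reduced
monomials. -/
theorem resultant_macaulay_formula (n : ℕ) (d : Fin (n + 1) → ℕ) (hd : ∀ i, 0 < d i)
    (R : MvPolynomial (CoeffIdx (n + 1) d) ℤ) (hR : IsResultant (n + 1) d R)
    (F : Fin (n + 1) → MvPolynomial (Fin (n + 1)) ℂ)
    (hF : ∀ i, (F i).IsHomogeneous (d i))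
    (δ : ℕ) (hδ : δ = (∑ i, d i) - n) :
    (macaulayMatrix d δ F).det =
      resEval d F R *
        Matrix.det (fun a b : {α : Mono (n + 1) δ // ¬ IsReducedMono d α} =>
          macaulayMatrix d δ F a.1 b.1) := by
  have h : ∑ i, (d i - 1) < δ := by
    have h1 : ∑ i, d i = ∑ i, (d i - 1) + (n + 1) := by
      rw [Finset.sum_congr rfl fun i _ => (Nat.sub_add_cancel (hd i)).symm,
        Finset.sum_add_distrib]
      simp
    omega
  rw [macaulayMatrix_eq_macaulayOf h F, resEval_eq_eval]
  exact hR.isComplexResultant.det_macaulayOf hd h _
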